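/- arXiv:2409.03313 — 3 statements merged into one kernel-verified Lean document; each statement's English description precedes it below -/
import Mathlib

section
/- Let α := √6/6. For every z ∈ ℂ with z ∉ (−∞, 2α] (i.e. z is not a real number ≤ 2α), the following integral identity holds: √(z − 2α) · ∫_{−α}^{2α} 1/(√(2α − ξ)·(ξ − z)) dξ = −i · Log( (i·√(z − 2α) + √(3α)) / (i·√(z − 2α) − √(3α)) ), where √(z − 2α) denotes the principal complex square root, √(2α − ξ) the nonnegative real square root (for ξ ∈ [−α, 2α]), and Log the principal complex logarithm. (Consequently, the Szegő function d(z) = exp(−(ln(−i s₀)/(2π))·√(z−2α)·∫_{−α}^{2α} dξ/(√(2α−ξ)(ξ−z))) equals ((i√(z−2α)+√(3α))/(i√(z−2α)−√(3α)))^ν with ν = −(1/(2πi))·ln(−i s₀).) -/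
theorem Complex.cpow_half_re_pos {x : ℂ} (hx : x ∈ Complex.slitPlane) :
    0 < (x ^ ((1 : ℂ) / 2)).re := by
  rw [Complex.cpow_def_of_ne_zero (Complex.slitPlane_ne_zero hx), Complex.exp_re]
  have harg := (Complex.mem_slitPlane_iff_arg.mp hx).1
  have him : (Complex.log x * ((1 : ℂ) / 2)).im = x.arg / 2 := by
    rw [mul_one_div, Complex.div_ofNat_im, Complex.log_im]
  rw [him]
  refine mul_pos (Real.exp_pos _) (Real.cos_pos_of_mem_Ioo ⟨?_, ?_⟩)
  · linarith [Complex.neg_pi_lt_arg x]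
  · linarith [lt_of_le_of_ne (Complex.arg_le_pi x) harg]

theorem Complex.I_mul_add_ofReal_ne_zero {w : ℂ} (hw : 0 < w.re) (s : ℝ) :
    Complex.I * w + s ≠ 0 := by
  intro h
  have := congrArg Complex.im h
  simp at this
  exact hw.ne' this

theorem Complex.I_mul_sub_ofReal_ne_zero {w : ℂ} (hw : 0 < w.re) (s : ℝ) :
    Complex.I * w - s ≠ 0 := by
  simpa [sub_eq_add_neg] using Complex.I_mul_add_ofReal_ne_zero hw (-s)

theorem Complex.I_mul_add_div_I_mul_sub_mem_slitPlane {w : ℂ} (hw : 0 < w.re) (s : ℝ) :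
    (Complex.I * w + s) / (Complex.I * w - s) ∈ Complex.slitPlane := by
  by_contra h
  rw [Complex.mem_slitPlane_iff, not_or, not_lt, not_not] at h
  set q := (Complex.I * w + s) / (Complex.I * w - s)
  have hmul : Complex.I * w + s = q * (Complex.I * w - s) :=
    (div_mul_cancel₀ _ (Complex.I_mul_sub_ofReal_ne_zero hw s)).symm
  have him := congrArg Complex.im hmul
  simp [h.2] at him
  nlinarith [h.1]

/-- `-i Log ((i w + s) / (i w - s))` is an antiderivative of `-2 w / (w ^ 2 + s ^ 2)`. -/
theorem Complex.hasDerivAt_neg_I_mul_log_div {w : ℂ} (hw : 0 < w.re) (s : ℝ) :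
    HasDerivAt (fun t : ℝ ↦ -Complex.I *
        Complex.log ((Complex.I * w + t) / (Complex.I * w - t)))
      (-2 * w / (w ^ 2 + s ^ 2)) s := by
  have hadd := Complex.I_mul_add_ofReal_ne_zero hw s
  have hsub := Complex.I_mul_sub_ofReal_ne_zero hw s
  have hs : HasDerivAt (fun t : ℝ ↦ (t : ℂ)) 1 s := Complex.ofRealCLM.hasDerivAt
  have hdiv := (hs.const_add (Complex.I * w)).fun_div (hs.const_sub (Complex.I * w)) hsub
  refine ((hdiv.clog_real (Complex.I_mul_add_div_I_mul_sub_mem_slitPlane hw s)).const_mul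
    (-Complex.I)).congr_deriv ?_
  have hprod : w ^ 2 + (s : ℂ) ^ 2 = -((Complex.I * w + s) * (Complex.I * w - s)) := by
    linear_combination (w ^ 2) * Complex.I_sq
  rw [hprod]
  field_simp
  linear_combination (-2 * w) * Complex.I_sq

theorem intervalIntegrable_inv_sqrt_const_sub {a b : ℝ} (hab : a ≤ b) :
    IntervalIntegrable (fun x ↦ (Real.sqrt (b - x))⁻¹) MeasureTheory.volume a b := by
  refine intervalIntegral.intervalIntegrable_deriv_of_nonneg
    (g := fun x ↦ -2 * Real.sqrt (b - x)) (by fun_prop) (fun x hx ↦ ?_) fun x _ ↦ by positivity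
  rw [min_eq_left hab, max_eq_right hab] at hx
  have hpos : 0 < b - x := sub_pos.mpr hx.2
  refine ((((hasDerivAt_id' x).const_sub b).sqrt hpos.ne').const_mul (-2)).congr_deriv ?_
  have := (Real.sqrt_pos.mpr hpos).ne'
  field_simp

/-- The integral of `1 / (√(b - ξ) (ξ - z))` over `[a, b]`, with `w` the square root of `z - b`
of positive real part. -/
theorem integral_one_div_sqrt_mul_sub {a b : ℝ} (hab : a ≤ b) {w z : ℂ} (hw : 0 < w.re)
    (hwz : w ^ 2 = z - b) :
    w * ∫ ξ in a..b, 1 / ((Real.sqrt (b - ξ) : ℂ) * ((ξ : ℂ) - z)) =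
      -Complex.I * Complex.log ((Complex.I * w + (Real.sqrt (b - a) : ℂ)) /
        (Complex.I * w - (Real.sqrt (b - a) : ℂ))) := by
  have hfac {ξ : ℝ} (hξ : ξ ≤ b) : w ^ 2 + (Real.sqrt (b - ξ) : ℂ) ^ 2 = z - ξ := by
    rw [← Complex.ofReal_pow, Real.sq_sqrt (sub_nonneg.mpr hξ), hwz]
    push_cast
    ring
  have hne {ξ : ℝ} (hξ : ξ ≤ b) : (ξ : ℂ) - z ≠ 0 := by
    rw [← neg_ne_zero, neg_sub, ← hfac hξ,
      show w ^ 2 + (Real.sqrt (b - ξ) : ℂ) ^ 2 =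
        -((Complex.I * w + (Real.sqrt (b - ξ) : ℂ)) * (Complex.I * w - (Real.sqrt (b - ξ) : ℂ))) by
        linear_combination (w ^ 2) * Complex.I_sq]
    exact neg_ne_zero.mpr (mul_ne_zero (Complex.I_mul_add_ofReal_ne_zero hw _)
      (Complex.I_mul_sub_ofReal_ne_zero hw _))
  set F : ℝ → ℂ := fun t ↦ -Complex.I *
    Complex.log ((Complex.I * w + t) / (Complex.I * w - t)) with hF
  have hFc : Continuous F := continuous_iff_continuousAt.mpr fun s ↦
    (Complex.hasDerivAt_neg_I_mul_log_div hw s).continuousAt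
  have hint : IntervalIntegrable
      (fun ξ : ℝ ↦ w * (1 / ((Real.sqrt (b - ξ) : ℂ) * ((ξ : ℂ) - z))))
      MeasureTheory.volume a b := by
    have hcont : ContinuousOn (fun ξ : ℝ ↦ w * ((ξ : ℂ) - z)⁻¹) (Set.uIcc a b) := by
      refine continuousOn_const.mul (ContinuousOn.inv₀ (by fun_prop) fun ξ hξ ↦ ?_)
      rw [Set.uIcc_of_le hab] at hξ
      exact hne hξ.2
    have hsqrt : IntervalIntegrable (fun ξ ↦ (((Real.sqrt (b - ξ))⁻¹ : ℝ) : ℂ))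
        MeasureTheory.volume a b :=
      ⟨(intervalIntegrable_inv_sqrt_const_sub hab).1.ofReal,
        (intervalIntegrable_inv_sqrt_const_sub hab).2.ofReal⟩
    refine (hsqrt.mul_continuousOn hcont).congr fun ξ _ ↦ ?_
    simp only [Complex.ofReal_inv, one_div, mul_inv]
    ring
  have hderiv : ∀ ξ ∈ Set.Ioo a b, HasDerivAt (fun ξ ↦ -F (Real.sqrt (b - ξ)))
      (w * (1 / ((Real.sqrt (b - ξ) : ℂ) * ((ξ : ℂ) - z)))) ξ := by
    intro ξ hξ
    have hpos : 0 < b - ξ := sub_pos.mpr hξ.2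
    have hs : (Real.sqrt (b - ξ) : ℂ) ≠ 0 :=
      Complex.ofReal_ne_zero.mpr (Real.sqrt_pos.mpr hpos).ne'
    have hd := (Complex.hasDerivAt_neg_I_mul_log_div hw (Real.sqrt (b - ξ))).scomp ξ
      (((hasDerivAt_id' ξ).const_sub b).sqrt hpos.ne')
    refine hd.neg.congr_deriv ?_
    have h1 := hne hξ.2.le
    rw [hfac hξ.2.le, ← neg_sub (ξ : ℂ) z, Complex.real_smul]
    push_cast
    field_simp
  rw [← intervalIntegral.integral_const_mul,
    intervalIntegral.integral_eq_sub_of_hasDerivAt_of_le hab (by fun_prop) hderiv hint]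
  have hIw : Complex.I * w ≠ 0 := by
    simpa using Complex.I_mul_add_ofReal_ne_zero hw 0
  simp [hF, div_self hIw]

open intervalIntegral in
/-- the integral identity behind the Szegő function: for `z` off the cut
`(-∞, 2α]` (with `α = √6/6`),
`√(z-2α) · ∫_{-α}^{2α} dξ/(√(2α-ξ)(ξ-z)) = -i·Log((i√(z-2α)+√(3α))/(i√(z-2α)-√(3α)))`. -/
theorem szego_integral_identity (α : ℝ) (hα : α = Real.sqrt 6 / 6)
    (z : ℂ) (hz : ¬(z.im = 0 ∧ z.re ≤ 2 * α)) :
    (z - 2 * (α : ℂ)) ^ ((1 : ℂ) / 2) *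
        ∫ ξ in (-α)..(2 * α), 1 / ((Real.sqrt (2 * α - ξ) : ℂ) * ((ξ : ℂ) - z))
      = -Complex.I * Complex.log
          ((Complex.I * (z - 2 * (α : ℂ)) ^ ((1 : ℂ) / 2) + (Real.sqrt (3 * α) : ℂ)) /
           (Complex.I * (z - 2 * (α : ℂ)) ^ ((1 : ℂ) / 2) - (Real.sqrt (3 * α) : ℂ))) := by
  have hα0 : 0 ≤ α := hα ▸ by positivity
  have hmem : z - 2 * (α : ℂ) ∈ Complex.slitPlane := by
    rw [Complex.mem_slitPlane_iff]
    by_contra h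
    simp only [not_or, not_lt, not_not] at h
    simp at h
    exact hz ⟨h.2, h.1⟩
  have hsq : ((z - 2 * (α : ℂ)) ^ ((1 : ℂ) / 2)) ^ 2 = z - ((2 * α : ℝ) : ℂ) := by
    rw [one_div, Complex.cpow_ofNat_inv_pow]
    push_cast
    rfl
  have := integral_one_div_sqrt_mul_sub (by linarith : -α ≤ 2 * α)
    (Complex.cpow_half_re_pos hmem) hsq
  rwa [show 2 * α - -α = 3 * α by ring] at this
end

section
/- Let x₀, y₀, b ∈ ℂ, let U ⊆ ℂ be open with y₀ ∉ U, let h : U → ℂ be holomorphic with h(z)² = z − y₀ for all z ∈ U, and let Ψ : U → M₂(ℂ) be holomorphic and satisfy the Painlevé I Lax equation Ψ′(z) = A(z)·Ψ(z) for all z ∈ U, where A(z) := [[b, 2z² + 2y₀z + x₀ + 2y₀²],[2(z − y₀), −b]]. Define Ψ̂(z) := [[0,1],[1, −(1/2)·(b + 1/(2(z − y₀)))]] · [[h(z), 0],[0, h(z)⁻¹]] · Ψ(z). Then Ψ̂′(z) = [[0,2],[V(z),0]]·Ψ̂(z) for all z ∈ U, where V is determined by 2·V(z) = b² + 4z³ +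 2x₀·z − 2x₀·y₀ − 4y₀³ + b/(z − y₀) + (3/4)/(z − y₀)². Consequently, each entry Y of the first row of Ψ̂ satisfies the scalar reduced triconfluent Heun-type equation Y″(z) = 2·V(z)·Y(z) on U. -/
/-- A holomorphic branch `h` of `√(z - c)` has derivative `1 / (2 * h z)` off its zeros. -/
theorem hasDerivAt_of_sq_eq_sub {U : Set ℂ} (hU : IsOpen U) {h : ℂ → ℂ} {c : ℂ}
    (hh : DifferentiableOn ℂ h U) (hsq : ∀ z ∈ U, (h z) ^ 2 = z - c)
    {z : ℂ} (hz : z ∈ U) (hne : h z ≠ 0) : HasDerivAt h (1 / (2 * h z)) z := by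
  have hd : HasDerivAt h (deriv h z) z := (hh.differentiableAt (hU.mem_nhds hz)).hasDerivAt
  have hsub : HasDerivAt (fun w => (h w) ^ 2) 1 z :=
    ((hasDerivAt_id z).sub_const c).congr_of_eventuallyEq <| by
      filter_upwards [hU.mem_nhds hz] with w hw using hsq w hw
  have heq := (hd.pow 2).unique hsub
  refine hd.congr_deriv ?_
  symm
  rw [div_eq_iff (by simpa using hne)]
  simp at heq
  linear_combination -heq

/-- the gauge transformation
`Ψ̂(z) = [[0,1],[1, -(1/2)(b + 1/(2(z-y₀)))]]·(z-y₀)^{σ₃/2}·Ψ(z)` turns the Painlevé I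
Lax equation `Ψ' = A Ψ` into the system `Ψ̂' = [[0,2],[V,0]] Ψ̂`, where
`2V(z) = b² + 4z³ + 2x₀z - 2x₀y₀ - 4y₀³ + b/(z-y₀) + (3/4)/(z-y₀)²`; consequently each
entry of the first row of `Ψ̂` solves the reduced triconfluent Heun-type equation
`Y'' = 2V·Y` on `U`. -/
theorem painleveI_lax_gauge_to_heun (x₀ y₀ b : ℂ) (U : Set ℂ) (hU : IsOpen U)
    (hy₀ : y₀ ∉ U)
    (h : ℂ → ℂ) (hh : DifferentiableOn ℂ h U)
    (hsq : ∀ z ∈ U, (h z) ^ 2 = z - y₀)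
    (Ψ : ℂ → Matrix (Fin 2) (Fin 2) ℂ)
    (hΨ : ∀ z ∈ U, ∀ i j : Fin 2, HasDerivAt (fun w => Ψ w i j)
        ((!![b, 2 * z ^ 2 + 2 * y₀ * z + x₀ + 2 * y₀ ^ 2; 2 * (z - y₀), -b] * Ψ z) i j) z)
    (Ψhat : ℂ → Matrix (Fin 2) (Fin 2) ℂ)
    (hΨhat : ∀ z : ℂ, Ψhat z =
      !![0, 1; 1, -(1 / 2) * (b + 1 / (2 * (z - y₀)))] *
        !![h z, 0; 0, (h z)⁻¹] * Ψ z)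
    (V : ℂ → ℂ)
    (hV : ∀ z : ℂ, 2 * V z = b ^ 2 + 4 * z ^ 3 + 2 * x₀ * z - 2 * x₀ * y₀ - 4 * y₀ ^ 3 +
      b / (z - y₀) + (3 / 4) / (z - y₀) ^ 2) :
    (∀ z ∈ U, ∀ i j : Fin 2, HasDerivAt (fun w => Ψhat w i j)
        ((!![0, 2; V z, 0] * Ψhat z) i j) z) ∧
    (∀ j : Fin 2, ∀ z ∈ U,
        deriv (deriv (fun w => Ψhat w 0 j)) z = 2 * V z * Ψhat z 0 j) := by
  have hrow0 : ∀ z j, Ψhat z 0 j = (h z)⁻¹ * Ψ z 1 j := fun z j => by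
    simp [hΨhat, Matrix.mul_apply, Fin.sum_univ_two]
  have hrow1 : ∀ z j, Ψhat z 1 j =
      h z * Ψ z 0 j + -(1 / 2) * (b + 1 / (2 * (z - y₀))) * ((h z)⁻¹ * Ψ z 1 j) := fun z j => by
    simp [hΨhat, Matrix.mul_apply, Fin.sum_univ_two]
    ring
  have hsystem : ∀ z ∈ U, ∀ i j : Fin 2, HasDerivAt (fun w => Ψhat w i j)
      ((!![0, 2; V z, 0] * Ψhat z) i j) z := by
    intro z hz i j
    have ht : z - y₀ ≠ 0 := sub_ne_zero.mpr fun e => hy₀ (e ▸ hz)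
    have hne : h z ≠ 0 := fun e => ht (by rw [← hsq z hz, e]; simp)
    have hd := hasDerivAt_of_sq_eq_sub hU hh hsq hz hne
    have hp := hΨ z hz 0 j
    have hq := hΨ z hz 1 j
    simp only [Matrix.mul_apply, Fin.sum_univ_two, Matrix.of_apply, Matrix.cons_val_zero,
      Matrix.cons_val_one, Matrix.cons_val', Matrix.cons_val_fin_one] at hp hq ⊢
    have hy : y₀ = z - h z ^ 2 := by rw [hsq z hz]; ring
    have hY := (hd.fun_inv hne).fun_mul hq
    fin_cases i
    · simp only [Fin.zero_eta, Matrix.cons_val_zero, hrow0, hrow1]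
      refine hY.congr_deriv ?_
      rw [← hsq z hz]
      field_simp
      ring
    · simp only [Fin.mk_one, Matrix.cons_val_one, hrow0, hrow1]
      have hc : HasDerivAt (fun w => -(1 / 2) * (b + 1 / (2 * (w - y₀))))
          (1 / (4 * (z - y₀) ^ 2)) z := by
        have h2 : HasDerivAt (fun w => 2 * (w - y₀)) (2 * 1) z :=
          ((hasDerivAt_id z).sub_const y₀).const_mul 2
        have h3 := ((h2.fun_inv (mul_ne_zero two_ne_zero ht)).const_add b).const_mul (-(1 / 2))
        simp only [one_div] at h3 ⊢
        refine h3.congr_deriv ?_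
        field_simp
        norm_num
      refine ((hd.fun_mul hp).fun_add (hc.fun_mul hY)).congr_deriv ?_
      have hVz : V z = (b ^ 2 + 4 * z ^ 3 + 2 * x₀ * z - 2 * x₀ * y₀ - 4 * y₀ ^ 3 +
          b / (z - y₀) + (3 / 4) / (z - y₀) ^ 2) / 2 := by
        rw [← hV z]; ring
      rw [hVz, ← hsq z hz, hy]
      field_simp
      ring
  refine ⟨hsystem, fun j z hz => ?_⟩
  have hfirst : deriv (fun w => Ψhat w 0 j) =ᶠ[nhds z] fun w => 2 * Ψhat w 1 j := by
    filter_upwards [hU.mem_nhds hz] with w hw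
    simpa [Matrix.mul_apply, Fin.sum_univ_two] using (hsystem w hw 0 j).deriv
  rw [hfirst.deriv_eq, ((hsystem z hz 1 j).const_mul 2).deriv]
  simp [Matrix.mul_apply, Fin.sum_univ_two, mul_assoc]
end

section
/- Define a sequence of real numbers by a₀ := 1 and a_m := 4·a_{m−1}/((5m)·(5m+1)) for m ≥ 1. Then the power series Y(z) := Σ_{m=0}^∞ a_m·z^{5m+1} has infinite radius of convergence, and its sum is an entire function satisfying Y″(z) = 4·z³·Y(z) for all z ∈ ℂ. -/
/-- An everywhere convergent series of complex monomials can be differentiated termwise, and the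
differentiated series again converges everywhere. -/
theorem hasDerivAt_tsum_monomial {c : ℕ → ℂ} {e : ℕ → ℕ}
    (h : ∀ z : ℂ, Summable fun m => c m * z ^ e m) (z : ℂ) :
    (Summable fun m => c m * e m * z ^ (e m - 1)) ∧
      HasDerivAt (fun w : ℂ => ∑' m, c m * w ^ e m) (∑' m, c m * e m * z ^ (e m - 1)) z := by
  have hz : z ∈ Metric.ball (0 : ℂ) (‖z‖ + 1) := by simp
  have hu : Summable fun m => ‖c m * ((‖z‖ + 1 : ℝ) : ℂ) ^ e m‖ := (h _).norm
  have hd : ∀ m, DifferentiableOn ℂ (fun w : ℂ => c m * w ^ e m) (Metric.ball 0 (‖z‖ + 1)) :=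
    fun m => by fun_prop
  have hb : ∀ (m : ℕ) (w : ℂ), w ∈ Metric.ball (0 : ℂ) (‖z‖ + 1) →
      ‖c m * w ^ e m‖ ≤ ‖c m * ((‖z‖ + 1 : ℝ) : ℂ) ^ e m‖ := by
    intro m w hw
    have hw' : ‖w‖ ≤ ‖z‖ + 1 := (mem_ball_zero_iff.mp hw).le
    rw [norm_mul, norm_mul, norm_pow, norm_pow, Complex.norm_of_nonneg (by positivity)]
    gcongr
  have hs := Complex.hasSum_deriv_of_summable_norm hu hd Metric.isOpen_ball hb hz
  have hdiff := (Complex.differentiableOn_tsum_of_summable_norm hu hd Metric.isOpen_ball hb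
    |>.differentiableAt (Metric.isOpen_ball.mem_nhds hz)).hasDerivAt
  have hterm : (fun m => deriv (fun w : ℂ => c m * w ^ e m) z) =
      fun m => c m * e m * z ^ (e m - 1) := by
    funext m
    simp [mul_assoc]
  rw [hterm] at hs
  rw [← hs.tsum_eq] at hdiff
  exact ⟨hs.summable, hdiff⟩

/-- the power series `Y(z) = Σ a_m z^{5m+1}` with `a₀ = 1` and
`a_m = 4 a_{m-1}/((5m)(5m+1))` for `m ≥ 1` converges for every `z ∈ ℂ` (infinite radius
of convergence), its sum is an entire function, and it satisfies the reduced triconfluent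
Heun equation `Y'' = 4z³ Y` on all of `ℂ`. -/
theorem reduced_heun_entire_solution (a : ℕ → ℝ)
    (h0 : a 0 = 1)
    (hrec : ∀ m : ℕ, 1 ≤ m → a m = 4 * a (m - 1) / ((5 * m) * (5 * m + 1))) :
    (∀ z : ℂ, Summable fun m : ℕ => (a m : ℂ) * z ^ (5 * m + 1)) ∧
    Differentiable ℂ (fun z : ℂ => ∑' m : ℕ, (a m : ℂ) * z ^ (5 * m + 1)) ∧
    (∀ z : ℂ, deriv (deriv (fun w : ℂ => ∑' m : ℕ, (a m : ℂ) * w ^ (5 * m + 1))) z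
        = 4 * z ^ 3 * ∑' m : ℕ, (a m : ℂ) * z ^ (5 * m + 1)) := by
  have hsucc : ∀ m : ℕ, a (m + 1) = 4 * a m / ((5 * (m + 1)) * (5 * (m + 1) + 1)) := by
    intro m
    simpa using hrec (m + 1) (by omega)
  have hbound : ∀ m : ℕ, |a m| ≤ 1 / (m.factorial : ℝ) := by
    intro m
    induction m with
    | zero => simp [h0]
    | succ m ih =>
      have hm : (0 : ℝ) ≤ m := m.cast_nonneg
      rw [hsucc, abs_div, abs_mul, abs_of_pos (by positivity : (0 : ℝ) < 4),
        abs_of_pos (by positivity : (0 : ℝ) < (5 * (m + 1)) * (5 * (m + 1) + 1)),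
        Nat.factorial_succ]
      push_cast
      calc 4 * |a m| / ((5 * (m + 1)) * (5 * (m + 1) + 1))
          = |a m| * (4 / (5 * (5 * ((m : ℝ) + 1) + 1))) * (1 / (m + 1)) := by
            field_simp
        _ ≤ (1 / (m.factorial : ℝ)) * 1 * (1 / (m + 1)) := by
            gcongr
            rw [div_le_one (by positivity)]
            linarith
        _ = 1 / (((m : ℝ) + 1) * m.factorial) := by
            field_simp
  have hsum : ∀ z : ℂ, Summable fun m : ℕ => (a m : ℂ) * z ^ (5 * m + 1) := by
    intro z
    refine Summable.of_norm_bounded ((Real.summable_pow_div_factorial (‖z‖ ^ 5)).mul_right ‖z‖) ?_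
    intro m
    calc ‖(a m : ℂ) * z ^ (5 * m + 1)‖ = |a m| * ‖z‖ ^ (5 * m + 1) := by simp
      _ ≤ 1 / (m.factorial : ℝ) * ‖z‖ ^ (5 * m + 1) := by
          gcongr
          exact hbound m
      _ = (‖z‖ ^ 5) ^ m / m.factorial * ‖z‖ := by ring
  have hd := hasDerivAt_tsum_monomial hsum
  refine ⟨hsum, fun z => (hd z).2.differentiableAt, fun z => ?_⟩
  have hd' := hasDerivAt_tsum_monomial (fun w => (hd w).1) z
  rw [funext fun w => (hd w).2.deriv, hd'.2.deriv, hd'.1.tsum_eq_zero_add, ← tsum_mul_left]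
  simp only [mul_zero, zero_add, Nat.sub_self, Nat.cast_zero, zero_mul]
  refine tsum_congr fun m => ?_
  have h1 : (5 * ((m : ℂ) + 1)) ≠ 0 := by exact_mod_cast (by omega : 5 * (m + 1) ≠ 0)
  have h2 : (5 * ((m : ℂ) + 1) + 1) ≠ 0 := by exact_mod_cast (by omega : 5 * (m + 1) + 1 ≠ 0)
  have hexp : 5 * (m + 1) + 1 - 1 - 1 = 5 * m + 4 := by omega
  rw [hexp, Nat.add_sub_cancel, hsucc]
  push_cast
  field_simp
  ring
end
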